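/- If F is a (2,3)-spread of V(7,2), then there exists a point P of V(7,2) such that the derived spread F_P in V/P is not geometric. -/

import Mathlib

abbrev V72 := Fin 7 → ZMod 2

/-- `F` is a (2,3)-spread of `V(7,2)`. -/
def IsSpread23 (F : Set (Submodule (ZMod 2) V72)) : Prop :=
  (∀ S ∈ F, Module.finrank (ZMod 2) S = 3) ∧
  ∀ s : Submodule (ZMod 2) V72, Module.finrank (ZMod 2) s = 2 →
    ∃! S, S ∈ F ∧ s ≤ S

/-- `P` is an alpha-point of `F`: `P` is a point, and every 5-dimensional subspace
containing two members of `F` through `P` has all its members of `F` through `P`. -/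
def IsAlphaPoint (F : Set (Submodule (ZMod 2) V72)) (P : Submodule (ZMod 2) V72) : Prop :=
  Module.finrank (ZMod 2) P = 1 ∧
  ∀ T : Submodule (ZMod 2) V72, Module.finrank (ZMod 2) T = 5 →
    (∃ S1 S2, S1 ∈ F ∧ S2 ∈ F ∧ S1 ≠ S2 ∧ S1 ≤ T ∧ S2 ≤ T ∧ P ≤ S1 ∧ P ≤ S2) →
    ∀ S ∈ F, S ≤ T → P ≤ S

/-- `P` is an alpha-point of the 5-dimensional subspace `T`: a point contained in
all members of `F` lying in `T`. -/
def IsAlphaPointOf (F : Set (Submodule (ZMod 2) V72)) (T P : Submodule (ZMod 2) V72) : Prop :=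
  Module.finrank (ZMod 2) P = 1 ∧ P ≤ T ∧ ∀ S ∈ F, S ≤ T → P ≤ S

/-- A spread of a vector space is geometric. -/
def IsGeometric {V : Type*} [AddCommGroup V] [Module (ZMod 2) V]
    (S : Set (Submodule (ZMod 2) V)) : Prop :=
  ∀ S1 ∈ S, ∀ S2 ∈ S, ∀ S3 ∈ S, S3 ⊓ (S1 ⊔ S2) ≠ ⊥ → S3 ≤ S1 ⊔ S2


section PlaneGeometry

lemma zmod_two_eq_zero_or_one (a : ZMod 2) : a = 0 ∨ a = 1 := by
  decide +revert

lemma finrank_span_singleton_V72 {x : V72} (hx : x ≠ 0) :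
    Module.finrank (ZMod 2) (Submodule.span (ZMod 2) {x}) = 1 :=
  finrank_span_singleton hx

lemma mem_span_singleton_zmod_two {x v : V72} :
    v ∈ Submodule.span (ZMod 2) {x} ↔ v = 0 ∨ v = x := by
  rw [Submodule.mem_span_singleton]
  constructor
  · rintro ⟨a, rfl⟩
    obtain rfl | rfl := zmod_two_eq_zero_or_one a <;> simp
  · rintro (rfl | rfl)
    · exact ⟨0, by simp⟩
    · exact ⟨1, by simp⟩

lemma mem_span_pair_zmod_two {x y v : V72} :
    v ∈ Submodule.span (ZMod 2) {x, y} ↔ v = 0 ∨ v = x ∨ v = y ∨ v = x + y := by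
  rw [Submodule.mem_span_pair]
  constructor
  · rintro ⟨a, b, rfl⟩
    obtain rfl | rfl := zmod_two_eq_zero_or_one a <;>
      obtain rfl | rfl := zmod_two_eq_zero_or_one b <;> simp
  · rintro (rfl | rfl | rfl | rfl)
    · exact ⟨0, 0, by simp⟩
    · exact ⟨1, 0, by simp⟩
    · exact ⟨0, 1, by simp⟩
    · exact ⟨1, 1, by simp⟩

lemma finrank_span_pair_zmod_two {x y : V72} (hx : x ≠ 0) (hy : y ≠ 0) (hxy : x ≠ y) :
    Module.finrank (ZMod 2) (Submodule.span (ZMod 2) {x, y}) = 2 := by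
  have h : LinearIndependent (ZMod 2) ![x, y] := by
    rw [LinearIndependent.pair_iff]
    intro a b
    obtain rfl | rfl := zmod_two_eq_zero_or_one a <;>
      obtain rfl | rfl := zmod_two_eq_zero_or_one b <;> simp [hx, hy]
    intro h
    exact hxy (by rw [← sub_eq_zero, ZModModule.sub_eq_add]; exact h)
  have := finrank_span_eq_card h
  rwa [Matrix.range_cons, Matrix.range_cons, Matrix.range_empty, Set.union_empty,
    Set.singleton_union, Fintype.card_fin] at this

lemma exists_mem_notMem_of_finrank_lt {A B : Submodule (ZMod 2) V72}
    (h : Module.finrank (ZMod 2) B < Module.finrank (ZMod 2) A) : ∃ v ∈ A, v ∉ B := by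
  by_contra! hc
  exact absurd (Submodule.finrank_mono (show A ≤ B from hc)) (by omega)

variable {F : Set (Submodule (ZMod 2) V72)}

lemma IsSpread23.exists_mem (hF : IsSpread23 F) {x y : V72} (hx : x ≠ 0) (hy : y ≠ 0)
    (hxy : x ≠ y) : ∃ S ∈ F, x ∈ S ∧ y ∈ S := by
  obtain ⟨S, ⟨hS, hle⟩, -⟩ := hF.2 _ (finrank_span_pair_zmod_two hx hy hxy)
  exact ⟨S, hS, hle (Submodule.subset_span (by simp)), hle (Submodule.subset_span (by simp))⟩

lemma IsSpread23.eq_of_mem (hF : IsSpread23 F) {x y : V72} (hx : x ≠ 0) (hy : y ≠ 0)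
    (hxy : x ≠ y) {S T : Submodule (ZMod 2) V72} (hS : S ∈ F) (hT : T ∈ F)
    (hxS : x ∈ S) (hyS : y ∈ S) (hxT : x ∈ T) (hyT : y ∈ T) : S = T := by
  refine (hF.2 _ (finrank_span_pair_zmod_two hx hy hxy)).unique ⟨hS, ?_⟩ ⟨hT, ?_⟩ <;>
    rw [Submodule.span_le] <;> rintro v (rfl | rfl) <;> assumption

lemma IsSpread23.mem_combination (hF : IsSpread23 F) {S : Submodule (ZMod 2) V72} (hS : S ∈ F)
    {x y z v : V72} (hx : x ≠ 0) (hy : y ≠ 0) (hxy : x ≠ y)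
    (hz : z ∉ Submodule.span (ZMod 2) {x, y})
    (hxS : x ∈ S) (hyS : y ∈ S) (hzS : z ∈ S) (hv : v ∈ S) :
    ∃ a : ZMod 2, ∃ u ∈ Submodule.span (ZMod 2) {x, y}, v = a • z + u := by
  have hle : Submodule.span (ZMod 2) {z, x, y} ≤ S := by
    rw [Submodule.span_le]
    rintro w (rfl | rfl | rfl) <;> assumption
  have hlt : Submodule.span (ZMod 2) {x, y} < Submodule.span (ZMod 2) {z, x, y} :=
    lt_of_le_of_ne (Submodule.span_mono (by simp)) fun h =>
      hz (h ▸ Submodule.subset_span (by simp))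
  have h3 := Submodule.finrank_lt_finrank_of_lt hlt
  rw [finrank_span_pair_zmod_two hx hy hxy] at h3
  have heq := Submodule.eq_of_le_of_finrank_le hle (by rw [hF.1 S hS]; omega)
  rw [← heq, Submodule.mem_span_insert] at hv
  exact hv

/-- The property that the derived spread at every point is geometric, in terms of vectors. -/
def GeometricAtPoints (F : Set (Submodule (ZMod 2) V72)) : Prop :=
  ∀ x u : V72, x ≠ 0 → u ≠ 0 → u ≠ x → ∀ S₁ ∈ F, ∀ S₂ ∈ F, ∀ S₃ ∈ F,
    x ∈ S₁ → x ∈ S₂ → x ∈ S₃ → u ∈ S₃ → u ∈ S₁ ⊔ S₂ → S₃ ≤ S₁ ⊔ S₂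

lemma geometricAtPoints_of_isGeometric
    (h : ∀ P : Submodule (ZMod 2) V72, Module.finrank (ZMod 2) P = 1 →
      IsGeometric {T : Submodule (ZMod 2) (V72 ⧸ P) | ∃ S ∈ F, P ≤ S ∧ T = S.map P.mkQ}) :
    GeometricAtPoints F := by
  intro x u hx hu hux S₁ h₁ S₂ h₂ S₃ h₃ hx₁ hx₂ hx₃ hu₃ hu₁₂
  set P := Submodule.span (ZMod 2) {x} with hP
  have hle : ∀ {S : Submodule (ZMod 2) V72}, x ∈ S → P ≤ S := fun hxS => by
    rw [hP, Submodule.span_le]; simpa using hxS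
  have key := h P (finrank_span_singleton_V72 hx) _ ⟨S₁, h₁, hle hx₁, rfl⟩
    _ ⟨S₂, h₂, hle hx₂, rfl⟩ _ ⟨S₃, h₃, hle hx₃, rfl⟩
  rw [← Submodule.map_sup] at key
  have hle' := key fun hbot => by
    have hmem : P.mkQ u ∈ S₃.map P.mkQ ⊓ (S₁ ⊔ S₂).map P.mkQ :=
      ⟨Submodule.mem_map_of_mem hu₃, Submodule.mem_map_of_mem hu₁₂⟩
    rw [hbot, Submodule.mem_bot, Submodule.mkQ_apply, Submodule.Quotient.mk_eq_zero, hP,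
      mem_span_singleton_zmod_two] at hmem
    exact hmem.elim hu hux
  rw [Submodule.map_le_iff_le_comap, Submodule.comap_map_mkQ] at hle'
  rwa [sup_eq_right.mpr ((hle hx₁).trans le_sup_left)] at hle'

end PlaneGeometry

section Orthogonality

/-- Orthogonality of vectors of `H` induced by the members of `F` contained in `H`. -/
def SpreadOrth (F : Set (Submodule (ZMod 2) V72)) (H : Submodule (ZMod 2) V72) (x y : V72) :
    Prop :=
  x = 0 ∨ y = 0 ∨ x = y ∨ ∃ S ∈ F, x ∈ S ∧ y ∈ S ∧ S ≤ H

variable {F : Set (Submodule (ZMod 2) V72)} {H : Submodule (ZMod 2) V72}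

lemma SpreadOrth.symm {x y : V72} (h : SpreadOrth F H x y) : SpreadOrth F H y x := by
  rcases h with h | h | h | ⟨S, hS, hx, hy, hle⟩
  · exact Or.inr (Or.inl h)
  · exact Or.inl h
  · exact Or.inr (Or.inr (Or.inl h.symm))
  · exact Or.inr (Or.inr (Or.inr ⟨S, hS, hy, hx, hle⟩))

lemma SpreadOrth.add (hF : IsSpread23 F) (hG : GeometricAtPoints F) {x y z : V72}
    (hy : SpreadOrth F H x y) (hz : SpreadOrth F H x z) : SpreadOrth F H x (y + z) := by
  by_cases hx0 : x = 0
  · exact Or.inl hx0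
  by_cases h0 : y + z = 0
  · exact Or.inr (Or.inl h0)
  by_cases hxyz : x = y + z
  · exact Or.inr (Or.inr (Or.inl hxyz))
  rcases hy with h | rfl | rfl | ⟨S₁, hS₁, hx₁, hy₁, hle₁⟩
  · exact absurd h hx0
  · rwa [zero_add]
  · rcases hz with h | rfl | rfl | ⟨S, hS, hx, hz, hle⟩
    · exact absurd h hx0
    · simp at hxyz
    · exact absurd (ZModModule.add_self _) h0
    · exact Or.inr (Or.inr (Or.inr ⟨S, hS, hx, S.add_mem hx hz, hle⟩))
  rcases hz with h | rfl | rfl | ⟨S₂, hS₂, hx₂, hz₂, hle₂⟩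
  · exact absurd h hx0
  · exact Or.inr (Or.inr (Or.inr ⟨S₁, hS₁, hx₁, by simpa using hy₁, hle₁⟩))
  · exact Or.inr (Or.inr (Or.inr ⟨S₁, hS₁, hx₁, S₁.add_mem hy₁ hx₁, hle₁⟩))
  obtain ⟨S₃, hS₃, hx₃, h₃⟩ := hF.exists_mem hx0 h0 hxyz
  refine Or.inr (Or.inr (Or.inr ⟨S₃, hS₃, hx₃, h₃, ?_⟩))
  exact (hG x (y + z) hx0 h0 (Ne.symm hxyz) S₁ hS₁ S₂ hS₂ S₃ hS₃ hx₁ hx₂ hx₃ h₃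
    (Submodule.add_mem_sup hy₁ hz₂)).trans (sup_le hle₁ hle₂)

lemma SpreadOrth.add_of_not (hF : IsSpread23 F) (hG : GeometricAtPoints F)
    (hH : ∀ u v : V72, u ∉ H → v ∉ H → u + v ∈ H) {x y z : V72}
    (hx : x ∈ H) (hy : y ∈ H) (hz : z ∈ H)
    (hxy : ¬ SpreadOrth F H x y) (hxz : ¬ SpreadOrth F H x z) : SpreadOrth F H x (y + z) := by
  by_cases h0 : y + z = 0
  · exact Or.inr (Or.inl h0)
  by_cases hxyz : x = y + z
  · exact Or.inr (Or.inr (Or.inl hxyz))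
  have hx0 : x ≠ 0 := fun h => hxy (Or.inl h)
  have hy0 : y ≠ 0 := fun h => hxy (Or.inr (Or.inl h))
  have hz0 : z ≠ 0 := fun h => hxz (Or.inr (Or.inl h))
  have hxy' : x ≠ y := fun h => hxy (Or.inr (Or.inr (Or.inl h)))
  have hxz' : x ≠ z := fun h => hxz (Or.inr (Or.inr (Or.inl h)))
  -- no member of `F` meeting the complement of `H` contains all of `x`, `y`, `z`
  have key : ∀ S ∈ F, x ∈ S → y ∈ S → z ∈ S → ∀ c ∈ S, c ∈ H := by
    intro S hS hxS hyS hzS c hc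
    have hzs : z ∉ Submodule.span (ZMod 2) {x, y} := by
      rw [mem_span_pair_zmod_two]
      rintro (h | h | h | h)
      · exact hz0 h
      · exact hxz' h.symm
      · exact h0 (by rw [h, ZModModule.add_self])
      · exact hxyz (by rw [h, add_left_comm, ZModModule.add_self, add_zero])
    obtain ⟨a, u, hu, rfl⟩ := hF.mem_combination hS hx0 hy0 hxy' hzs hxS hyS hzS hc
    refine H.add_mem (H.smul_mem a hz) (?_ : u ∈ H)
    have : Submodule.span (ZMod 2) {x, y} ≤ H := by
      rw [Submodule.span_le]
      rintro w (rfl | rfl) <;> assumption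
    exact this hu
  obtain ⟨S₁, hS₁, hx₁, hy₁⟩ := hF.exists_mem hx0 hy0 hxy'
  obtain ⟨S₂, hS₂, hx₂, hz₂⟩ := hF.exists_mem hx0 hz0 hxz'
  obtain ⟨S₃, hS₃, hx₃, h₃⟩ := hF.exists_mem hx0 h0 hxyz
  have hle := hG x (y + z) hx0 h0 (Ne.symm hxyz) S₁ hS₁ S₂ hS₂ S₃ hS₃ hx₁ hx₂ hx₃ h₃
    (Submodule.add_mem_sup hy₁ hz₂)
  have not_both : ∀ S ∈ F, x ∈ S → (y ∈ S ∨ z ∈ S) → ∀ c ∈ S, c ∈ S₃ → c ∈ H := by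
    intro S hS hxS hyz c hc hc₃
    by_contra hcH
    have hS₃' : S = S₃ := hF.eq_of_mem (y := c) hx0 (fun h => hcH (h ▸ H.zero_mem))
      (fun h => hcH (h ▸ hx)) hS hS₃ hxS hc hx₃ hc₃
    rw [← hS₃'] at h₃
    rcases hyz with h | h
    · exact hcH (key S hS hxS h (by simpa using S.sub_mem h₃ h) c hc)
    · exact hcH (key S hS hxS (by simpa using S.sub_mem h₃ h) h c hc)
  -- a member of `F` through `x` and `t ∈ H` not contained in `H` meets `H` in `⟨x, t⟩`
  have inter : ∀ S ∈ F, ∀ t ∈ S, t ∈ H → x ∈ S → ¬ SpreadOrth F H x t → ∀ b ∈ S, b ∈ H →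
      b = 0 ∨ b = x ∨ b = t ∨ b = x + t := by
    intro S hS t ht htH hxS hxt b hb hbH
    rw [← mem_span_pair_zmod_two]
    by_contra hbs
    refine hxt (Or.inr (Or.inr (Or.inr ⟨S, hS, hxS, ht, fun c hc => ?_⟩)))
    obtain ⟨a, u, hu, rfl⟩ := hF.mem_combination hS hx0 (fun h => hxt (Or.inr (Or.inl h)))
      (fun h => hxt (Or.inr (Or.inr (Or.inl h)))) hbs hxS ht hb hc
    refine H.add_mem (H.smul_mem a hbH) (?_ : u ∈ H)
    have : Submodule.span (ZMod 2) {x, t} ≤ H := by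
      rw [Submodule.span_le]
      rintro w (rfl | rfl) <;> assumption
    exact this hu
  refine Or.inr (Or.inr (Or.inr ⟨S₃, hS₃, hx₃, h₃, fun v hv => ?_⟩))
  obtain ⟨a, ha, b, hb, rfl⟩ := Submodule.mem_sup.mp (hle hv)
  by_cases haH : a ∈ H <;> by_cases hbH : b ∈ H
  · exact H.add_mem haH hbH
  · rcases inter S₁ hS₁ y hy₁ hy hx₁ hxy a ha haH with h | h | h | h
    · exact not_both S₂ hS₂ hx₂ (Or.inr hz₂) _ (S₂.add_mem (by simp [h]) hb) hv
    · exact not_both S₂ hS₂ hx₂ (Or.inr hz₂) _ (S₂.add_mem (by simpa [h]) hb) hv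
    · have := not_both S₂ hS₂ hx₂ (Or.inr hz₂) (b + z) (S₂.add_mem hb hz₂) (by
        convert S₃.add_mem hv h₃ using 1
        rw [h, add_add_add_comm, ZModModule.add_self, zero_add])
      exact absurd (by simpa using H.sub_mem this hz) hbH
    · have := not_both S₂ hS₂ hx₂ (Or.inr hz₂) (b + z) (S₂.add_mem hb hz₂) (by
        convert S₃.sub_mem (S₃.add_mem hv h₃) hx₃ using 1
        rw [h, show x + y + b + (y + z) - x = (y + y) + (b + z) by abel, ZModModule.add_self,
          zero_add])
      exact absurd (by simpa using H.sub_mem this hz) hbH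
  · rcases inter S₂ hS₂ z hz₂ hz hx₂ hxz b hb hbH with h | h | h | h
    · exact not_both S₁ hS₁ hx₁ (Or.inl hy₁) _ (S₁.add_mem ha (by simp [h])) hv
    · exact not_both S₁ hS₁ hx₁ (Or.inl hy₁) _ (S₁.add_mem ha (by simpa [h])) hv
    · have := not_both S₁ hS₁ hx₁ (Or.inl hy₁) (a + y) (S₁.add_mem ha hy₁) (by
        convert S₃.add_mem hv h₃ using 1
        rw [h, show a + z + (y + z) = (z + z) + (a + y) by abel, ZModModule.add_self, zero_add])
      exact absurd (by simpa using H.sub_mem this hy) haH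
    · have := not_both S₁ hS₁ hx₁ (Or.inl hy₁) (a + y) (S₁.add_mem ha hy₁) (by
        convert S₃.sub_mem (S₃.add_mem hv h₃) hx₃ using 1
        rw [h, show a + (x + z) + (y + z) - x = (z + z) + (a + y) by abel, ZModModule.add_self,
          zero_add])
      exact absurd (by simpa using H.sub_mem this hy) haH
  · exact hH a b haH hbH

lemma exists_not_spreadOrth (hF : IsSpread23 F) (hG : GeometricAtPoints F)
    (hH : Module.finrank (ZMod 2) H = 6) {x : V72} (hx : x ≠ 0) :
    ∃ y ∈ H, ¬ SpreadOrth F H x y := by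
  by_contra! hall
  have member : ∀ y ∈ H, y ∉ Submodule.span (ZMod 2) {x} → ∃ S ∈ F, x ∈ S ∧ y ∈ S ∧ S ≤ H := by
    intro y hy hyx
    rw [mem_span_singleton_zmod_two] at hyx
    rcases hall y hy with h | h | h | h
    · exact absurd h hx
    · exact absurd (Or.inl h) hyx
    · exact absurd (Or.inr h.symm) hyx
    · exact h
  obtain ⟨y₁, hy₁, hyx₁⟩ := exists_mem_notMem_of_finrank_lt
    (A := H) (B := Submodule.span (ZMod 2) {x}) (by rw [finrank_span_singleton_V72 hx]; omega)
  obtain ⟨S₁, hS₁, hx₁, hyS₁, hle₁⟩ := member y₁ hy₁ hyx₁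
  have hspan : ∀ {S : Submodule (ZMod 2) V72}, x ∈ S → Submodule.span (ZMod 2) {x} ≤ S := fun h =>
    (Submodule.span_singleton_le_iff_mem _ _).mpr h
  obtain ⟨y₂, hy₂, hyx₂⟩ := exists_mem_notMem_of_finrank_lt
    (A := H) (B := S₁) (by rw [hF.1 _ hS₁]; omega)
  obtain ⟨S₂, hS₂, hx₂, hyS₂, hle₂⟩ := member y₂ hy₂ fun h => hyx₂ (hspan hx₁ h)
  have hinf : S₁ ⊓ S₂ ≤ Submodule.span (ZMod 2) {x} := by
    intro u hu
    rw [mem_span_singleton_zmod_two]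
    by_contra! hux
    exact hyx₂ (hF.eq_of_mem hx hux.1 hux.2.symm hS₁ hS₂ hx₁ hu.1 hx₂ hu.2 ▸ hyS₂)
  have hinf₁ := Submodule.finrank_mono hinf
  have hinf₂ := Submodule.finrank_mono (le_inf (hspan hx₁) (hspan hx₂))
  rw [finrank_span_singleton_V72 hx] at hinf₁ hinf₂
  have hsup := Submodule.finrank_sup_add_finrank_inf_eq S₁ S₂
  rw [hF.1 _ hS₁, hF.1 _ hS₂] at hsup
  obtain ⟨y₃, hy₃, hyx₃⟩ := exists_mem_notMem_of_finrank_lt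
    (A := H) (B := S₁ ⊔ S₂) (by omega)
  obtain ⟨S₃, hS₃, hx₃, hyS₃, hle₃⟩ := member y₃ hy₃ fun h =>
    hyx₃ (hspan (le_sup_left (a := S₁) hx₁) h)
  have hsup₃ := Submodule.finrank_sup_add_finrank_inf_eq S₃ (S₁ ⊔ S₂)
  have hle := Submodule.finrank_mono (sup_le hle₃ (sup_le hle₁ hle₂))
  rw [hF.1 _ hS₃] at hsup₃
  obtain ⟨u, hu, hux⟩ := exists_mem_notMem_of_finrank_lt
    (A := S₃ ⊓ (S₁ ⊔ S₂)) (B := Submodule.span (ZMod 2) {x})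
    (by rw [finrank_span_singleton_V72 hx]; omega)
  rw [mem_span_singleton_zmod_two, not_or] at hux
  exact hyx₃ (hG x u hx hux.1 hux.2 S₁ hS₁ S₂ hS₂ S₃ hS₃ hx₁ hx₂ hx₃ hu.1 hu.2 hyS₃)

open Classical in
lemma exists_bilinForm_of_geometricAtPoints (hF : IsSpread23 F) (hG : GeometricAtPoints F)
    (hH : ∀ u v : V72, u ∉ H → v ∉ H → u + v ∈ H) :
    ∃ B : H →ₗ[ZMod 2] H →ₗ[ZMod 2] ZMod 2, ∀ x y, B x y = 0 ↔ SpreadOrth F H x y := by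
  let ω : H → H → ZMod 2 := fun x y => if SpreadOrth F H x y then 0 else 1
  have hadd : ∀ x y z : H, ω x (y + z) = ω x y + ω x z := by
    intro x y z
    have h₁ := SpreadOrth.add (F := F) (H := H) (x := x) (y := y) (z := z) hF hG
    have h₂ := SpreadOrth.add (F := F) (H := H) (x := x) (y := y) (z := (y + z : H)) hF hG
    have h₃ := SpreadOrth.add (F := F) (H := H) (x := x) (y := z) (z := (y + z : H)) hF hG
    have h₄ := SpreadOrth.add_of_not (x := x) (y := y) (z := z) hF hG hH x.2 y.2 z.2
    have e₂ : (y : V72) + (y + z : H) = z := by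
      rw [Submodule.coe_add, ← add_assoc, ZModModule.add_self, zero_add]
    have e₃ : (z : V72) + (y + z : H) = y := by
      rw [Submodule.coe_add, add_left_comm, ZModModule.add_self, add_zero]
    rw [e₂] at h₂
    rw [e₃] at h₃
    rw [← Submodule.coe_add] at h₁ h₄
    by_cases hy : SpreadOrth F H x y <;> by_cases hz : SpreadOrth F H x z <;>
      by_cases hyz : SpreadOrth F H x (y + z : H) <;>
      simp only [ω, hy, hz, hyz, if_true, if_false] <;> tauto
  have hsymm : ∀ x y : H, ω x y = ω y x := by
    intro x y
    have : SpreadOrth F H x y ↔ SpreadOrth F H y x := ⟨.symm, .symm⟩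
    simp only [ω, this]
  have hzero : ∀ x : H, ω x 0 = 0 := fun x => by simp [ω, SpreadOrth]
  have hsmul : ∀ (c : ZMod 2) (x y : H), ω x (c • y) = c • ω x y := by
    intro c x y
    obtain rfl | rfl := zmod_two_eq_zero_or_one c
    · rw [zero_smul, zero_smul, hzero]
    · rw [one_smul, one_smul]
  refine ⟨LinearMap.mk₂ (ZMod 2) ω (fun x y z => ?_) (fun c x y => ?_) hadd hsmul, fun x y => ?_⟩
  · rw [hsymm, hadd, hsymm z x, hsymm z y]
  · rw [hsymm, hsmul, hsymm]
  · simp [ω]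

end Orthogonality

section SymplecticCoordinates

/-- The standard symplectic form in dimension four over the field of two elements. -/
def symplecticForm₄ (x y : Fin 4 → ZMod 2) : ZMod 2 :=
  x 0 * y 1 + x 1 * y 0 + x 2 * y 3 + x 3 * y 2

/-- The standard symplectic form in dimension six over the field of two elements. -/
def symplecticForm₆ (x y : Fin 6 → ZMod 2) : ZMod 2 :=
  x 0 * y 1 + x 1 * y 0 + x 2 * y 3 + x 3 * y 2 + x 4 * y 5 + x 5 * y 4

lemma symplecticForm₆_nondegenerate :
    ∀ x : Fin 6 → ZMod 2, (∀ i : Fin 6, symplecticForm₆ x (Pi.single i 1) = 0) → x = 0 := by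
  decide +kernel

lemma exists_symplectic_coordinates {E : Type*} [AddCommGroup E] [Module (ZMod 2) E]
    (hE : Module.finrank (ZMod 2) E = 6) (B : E →ₗ[ZMod 2] E →ₗ[ZMod 2] ZMod 2)
    (halt : ∀ x, B x x = 0) (hsymm : ∀ x y, B x y = B y x)
    (hnd : ∀ x, x ≠ 0 → ∃ y, B x y ≠ 0) :
    ∃ g : (Fin 6 → ZMod 2) ≃ₗ[ZMod 2] E, ∀ u v, B (g u) (g v) = symplecticForm₆ u v := by
  have : FiniteDimensional (ZMod 2) E := Module.finite_of_finrank_pos (by omega)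
  have hnd' : ∀ x, x ≠ 0 → ∃ y, B x y = 1 := fun x hx =>
    (hnd x hx).imp fun y hy => (zmod_two_eq_zero_or_one _).resolve_left hy
  have : Nontrivial E := Module.nontrivial_of_finrank_pos (R := ZMod 2) (by omega)
  obtain ⟨p, hp⟩ := exists_ne (0 : E)
  obtain ⟨q, hpq⟩ := hnd' p hp
  have hqp : B q p = 1 := by rw [hsymm, hpq]
  obtain ⟨e₁, he₁, he₁0⟩ := Submodule.exists_mem_ne_zero_of_ne_bot
    (LinearMap.ker_ne_bot_of_finrank_lt (f := LinearMap.pi ![B p, B q]) (by simp [hE]))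
  have hpe₁ : B p e₁ = 0 := congrFun he₁ 0
  have hqe₁ : B q e₁ = 0 := congrFun he₁ 1
  obtain ⟨y, hy⟩ := hnd' e₁ he₁0
  let f₁ := y + B q y • p + B p y • q
  have hpf₁ : B p f₁ = 0 := by simp [f₁, halt, hpq, CharTwo.add_self_eq_zero]
  have hqf₁ : B q f₁ = 0 := by simp [f₁, halt, hqp, CharTwo.add_self_eq_zero]
  have hef₁ : B e₁ f₁ = 1 := by simp [f₁, hsymm e₁ p, hsymm e₁ q, hpe₁, hqe₁, hy]
  have hfe₁ : B f₁ e₁ = 1 := by rw [hsymm, hef₁]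
  clear_value f₁
  obtain ⟨e₂, he₂, he₂0⟩ := Submodule.exists_mem_ne_zero_of_ne_bot
    (LinearMap.ker_ne_bot_of_finrank_lt (f := LinearMap.pi ![B p, B q, B e₁, B f₁]) (by simp [hE]))
  have hpe₂ : B p e₂ = 0 := congrFun he₂ 0
  have hqe₂ : B q e₂ = 0 := congrFun he₂ 1
  have hee : B e₁ e₂ = 0 := congrFun he₂ 2
  have hfe : B f₁ e₂ = 0 := congrFun he₂ 3
  obtain ⟨z, hz⟩ := hnd' e₂ he₂0
  let f₂ := z + B q z • p + B p z • q + B f₁ z • e₁ + B e₁ z • f₁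
  have hpf₂ : B p f₂ = 0 := by simp [f₂, halt, hpq, hpe₁, hpf₁, CharTwo.add_self_eq_zero]
  have hqf₂ : B q f₂ = 0 := by simp [f₂, halt, hqp, hqe₁, hqf₁, CharTwo.add_self_eq_zero]
  have hef : B e₁ f₂ = 0 := by
    simp [f₂, halt, hsymm e₁ p, hsymm e₁ q, hpe₁, hqe₁, hef₁, CharTwo.add_self_eq_zero]
  have hff : B f₁ f₂ = 0 := by
    simp [f₂, halt, hsymm f₁ p, hsymm f₁ q, hpf₁, hqf₁, hfe₁, CharTwo.add_self_eq_zero]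
  have hef₂ : B e₂ f₂ = 1 := by
    simp [f₂, hsymm e₂ p, hsymm e₂ q, hsymm e₂ e₁, hsymm e₂ f₁, hpe₂, hqe₂, hee, hfe, hz]
  clear_value f₂
  let g := Fintype.linearCombination (ZMod 2) ![p, q, e₁, f₁, e₂, f₂]
  have hg : ∀ u v, B (g u) (g v) = symplecticForm₆ u v := by
    intro u v
    simp [g, Fintype.linearCombination_apply, Fin.sum_univ_succ, symplecticForm₆, halt, hpq,
      hqp, hpe₁, hqe₁, hpf₁, hqf₁, hef₁, hfe₁, hpe₂, hqe₂, hee, hfe, hpf₂, hqf₂, hef, hff, hef₂,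
      hsymm e₁ p, hsymm e₁ q, hsymm f₁ p, hsymm f₁ q, hsymm e₂ p, hsymm e₂ q, hsymm e₂ e₁,
      hsymm e₂ f₁, hsymm f₂ p, hsymm f₂ q, hsymm f₂ e₁, hsymm f₂ f₁, hsymm f₂ e₂]
    ring
  have hinj : Function.Injective g := by
    rw [injective_iff_map_eq_zero]
    intro u hu
    refine symplecticForm₆_nondegenerate u fun i => ?_
    rw [← hg, hu, map_zero, LinearMap.zero_apply]
  exact ⟨LinearEquiv.ofInjectiveOfFinrankEq g hinj (by simp [hE]), hg⟩

end SymplecticCoordinates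

section Doily

/-- The points of the symplectic generalized quadrangle of order two. -/
def doilyPoint : Fin 15 → (Fin 4 → ZMod 2) :=
  ![![1, 0, 0, 0], ![0, 1, 0, 0], ![1, 1, 0, 0], ![0, 0, 1, 0], ![1, 0, 1, 0],
    ![0, 1, 1, 0], ![1, 1, 1, 0], ![0, 0, 0, 1], ![1, 0, 0, 1], ![0, 1, 0, 1],
    ![1, 1, 0, 1], ![0, 0, 1, 1], ![1, 0, 1, 1], ![0, 1, 1, 1], ![1, 1, 1, 1]]

/-- Two points on each line of the symplectic generalized quadrangle of order two. -/
def doilyLine : Fin 15 → (Fin 4 → ZMod 2) × (Fin 4 → ZMod 2) :=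
  ![(![1, 0, 0, 0], ![0, 0, 1, 0]), (![1, 0, 0, 0], ![0, 0, 0, 1]), (![1, 0, 0, 0], ![0, 0, 1, 1]),
    (![0, 1, 0, 0], ![0, 0, 1, 0]), (![0, 1, 0, 0], ![0, 0, 0, 1]), (![0, 1, 0, 0], ![0, 0, 1, 1]),
    (![1, 1, 0, 0], ![0, 0, 1, 0]), (![1, 1, 0, 0], ![0, 0, 0, 1]), (![1, 1, 0, 0], ![0, 0, 1, 1]),
    (![1, 0, 1, 0], ![0, 1, 0, 1]), (![1, 0, 1, 0], ![1, 1, 0, 1]), (![0, 1, 1, 0], ![1, 0, 0, 1]),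
    (![0, 1, 1, 0], ![1, 1, 0, 1]), (![1, 1, 1, 0], ![1, 0, 0, 1]), (![1, 1, 1, 0], ![0, 1, 0, 1])]

/-- The three lines through each point of the symplectic generalized quadrangle of order two. -/
def doilyLinesThrough : Fin 15 → Fin 3 → Fin 15 :=
  ![![0, 1, 2], ![3, 4, 5], ![6, 7, 8], ![0, 3, 6], ![0, 9, 10],
    ![3, 11, 12], ![6, 13, 14], ![1, 4, 7], ![1, 11, 13], ![4, 9, 14],
    ![7, 10, 12], ![2, 5, 8], ![2, 12, 14], ![5, 10, 13], ![8, 9, 11]]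

lemma doilyLinesThrough_complete : ∀ (i : Fin 15) (y : Fin 4 → ZMod 2), y ≠ 0 →
    y ≠ doilyPoint i → symplecticForm₄ (doilyPoint i) y = 0 → ∃ j,
      ((doilyLine (doilyLinesThrough i j)).1 = doilyPoint i ∨
        (doilyLine (doilyLinesThrough i j)).1 = y ∨
        (doilyLine (doilyLinesThrough i j)).1 = doilyPoint i + y) ∧
      ((doilyLine (doilyLinesThrough i j)).2 = doilyPoint i ∨
        (doilyLine (doilyLinesThrough i j)).2 = y ∨
        (doilyLine (doilyLinesThrough i j)).2 = doilyPoint i + y) := by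
  decide +kernel

lemma doilyPoint_mem_line : ∀ (i : Fin 15) (j : Fin 3),
    doilyPoint i = (doilyLine (doilyLinesThrough i j)).1 ∨
    doilyPoint i = (doilyLine (doilyLinesThrough i j)).2 ∨
    doilyPoint i = (doilyLine (doilyLinesThrough i j)).1 +
      (doilyLine (doilyLinesThrough i j)).2 := by
  decide +kernel

lemma doilyPoint_ne_zero : ∀ i, doilyPoint i ≠ 0 := by
  decide +kernel

lemma doilyLine_independent : ∀ i, (doilyLine i).1 ≠ 0 ∧ (doilyLine i).2 ≠ 0 ∧
    (doilyLine i).1 ≠ (doilyLine i).2 := by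
  decide +kernel

lemma doilyLine_distinct : ∀ (i : Fin 15) (j k : Fin 3), j ≠ k →
    ∃ y ∈ [(doilyLine (doilyLinesThrough i k)).1, (doilyLine (doilyLinesThrough i k)).2],
      y ∉ [0, (doilyLine (doilyLinesThrough i j)).1, (doilyLine (doilyLinesThrough i j)).2,
        (doilyLine (doilyLinesThrough i j)).1 + (doilyLine (doilyLinesThrough i j)).2] := by
  decide +kernel

lemma not_disjoint_of_exactly_one_line_through_point (l m : Fin 15 → Prop)
    (hl : ∀ i, ∃ j, l (doilyLinesThrough i j))
    (hl' : ∀ i j k, j ≠ k → l (doilyLinesThrough i j) → ¬ l (doilyLinesThrough i k))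
    (hm : ∀ i, ∃ j, m (doilyLinesThrough i j))
    (hm' : ∀ i j k, j ≠ k → m (doilyLinesThrough i j) → ¬ m (doilyLinesThrough i k))
    (hd : ∀ i, l i → ¬ m i) : False := by
  have hl₀ := fun i => hl' i 0 1 (by decide)
  have hl₁ := fun i => hl' i 0 2 (by decide)
  have hl₂ := fun i => hl' i 1 2 (by decide)
  have hm₀ := fun i => hm' i 0 1 (by decide)
  have hm₁ := fun i => hm' i 0 2 (by decide)
  have hm₂ := fun i => hm' i 1 2 (by decide)
  clear hl' hm'
  simp [Fin.forall_fin_succ, Fin.exists_fin_succ, doilyLinesThrough] at hl hl₀ hl₁ hl₂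
  simp [Fin.forall_fin_succ, Fin.exists_fin_succ, doilyLinesThrough] at hm hm₀ hm₁ hm₂ hd
  grind (splits := 30)

/-- A family of subspaces that pairwise meet trivially, each consisting of at most four vectors,
such that every nonzero vector `x` lies in one of them together with a nonzero vector `y ≠ x`
orthogonal to `x`. -/
structure IsSymplecticSpread (L : Set (Submodule (ZMod 2) (Fin 4 → ZMod 2))) : Prop where
  exists_mem : ∀ x, x ≠ 0 → ∃ S ∈ L, x ∈ S ∧ ∃ y ∈ S, y ≠ 0 ∧ y ≠ x ∧ symplecticForm₄ x y = 0
  eq_of_mem : ∀ S ∈ L, ∀ T ∈ L, ∀ x, x ≠ 0 → x ∈ S → x ∈ T → S = T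
  mem_combination : ∀ S ∈ L, ∀ x ∈ S, ∀ y ∈ S, ∀ z ∈ S, x ≠ 0 → y ≠ 0 → x ≠ y →
    z = 0 ∨ z = x ∨ z = y ∨ z = x + y

variable {L M : Set (Submodule (ZMod 2) (Fin 4 → ZMod 2))}

lemma IsSymplecticSpread.exists_doilyLine (hL : IsSymplecticSpread L) (i : Fin 15) :
    ∃ j, ∃ S ∈ L, (doilyLine (doilyLinesThrough i j)).1 ∈ S ∧
      (doilyLine (doilyLinesThrough i j)).2 ∈ S := by
  obtain ⟨S, hS, hx, y, hy, hy0, hyx, hxy⟩ := hL.exists_mem _ (doilyPoint_ne_zero i)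
  obtain ⟨j, h₁, h₂⟩ := doilyLinesThrough_complete i y hy0 hyx hxy
  have aux : ∀ u, (u = doilyPoint i ∨ u = y ∨ u = doilyPoint i + y) → u ∈ S := by
    rintro u (rfl | rfl | rfl)
    exacts [hx, hy, S.add_mem hx hy]
  exact ⟨j, S, hS, aux _ h₁, aux _ h₂⟩

lemma IsSymplecticSpread.doilyLine_unique (hL : IsSymplecticSpread L) (i : Fin 15) (j k : Fin 3)
    (hjk : j ≠ k)
    (hj : ∃ S ∈ L, (doilyLine (doilyLinesThrough i j)).1 ∈ S ∧
      (doilyLine (doilyLinesThrough i j)).2 ∈ S) :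
    ¬ ∃ S ∈ L, (doilyLine (doilyLinesThrough i k)).1 ∈ S ∧
      (doilyLine (doilyLinesThrough i k)).2 ∈ S := by
  rintro ⟨T, hT, hT₁, hT₂⟩
  obtain ⟨S, hS, hS₁, hS₂⟩ := hj
  have aux : ∀ {R : Submodule (ZMod 2) (Fin 4 → ZMod 2)} {u v w : Fin 4 → ZMod 2},
      v ∈ R → w ∈ R → (u = v ∨ u = w ∨ u = v + w) → u ∈ R := by
    rintro R u v w hv hw (rfl | rfl | rfl)
    exacts [hv, hw, R.add_mem hv hw]
  obtain rfl := hL.eq_of_mem S hS T hT _ (doilyPoint_ne_zero i)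
    (aux hS₁ hS₂ (doilyPoint_mem_line i j)) (aux hT₁ hT₂ (doilyPoint_mem_line i k))
  obtain ⟨y, hy, hy'⟩ := doilyLine_distinct i j k hjk
  have hyS : y ∈ S := by
    simp only [List.mem_cons, List.not_mem_nil, or_false] at hy
    rcases hy with rfl | rfl <;> assumption
  obtain ⟨h₁, h₂, h₃⟩ := doilyLine_independent (doilyLinesThrough i j)
  refine hy' ?_
  simp only [List.mem_cons, List.not_mem_nil, or_false]
  exact hL.mem_combination S hS _ hS₁ _ hS₂ y hyS h₁ h₂ h₃

lemma IsSymplecticSpread.exists_common_line (hL : IsSymplecticSpread L)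
    (hM : IsSymplecticSpread M) :
    ∃ S ∈ L, ∃ T ∈ M, ∃ x y : Fin 4 → ZMod 2, x ≠ 0 ∧ y ≠ 0 ∧ x ≠ y ∧
      x ∈ S ∧ y ∈ S ∧ x ∈ T ∧ y ∈ T := by
  by_contra hc
  refine not_disjoint_of_exactly_one_line_through_point
    (fun i => ∃ S ∈ L, (doilyLine i).1 ∈ S ∧ (doilyLine i).2 ∈ S)
    (fun i => ∃ S ∈ M, (doilyLine i).1 ∈ S ∧ (doilyLine i).2 ∈ S)
    hL.exists_doilyLine hL.doilyLine_unique hM.exists_doilyLine hM.doilyLine_unique ?_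
  rintro i ⟨S, hS, hS₁, hS₂⟩ ⟨T, hT, hT₁, hT₂⟩
  obtain ⟨h₁, h₂, h₃⟩ := doilyLine_independent i
  exact hc ⟨S, hS, T, hT, _, _, h₁, h₂, h₃, hS₁, hS₂, hT₁, hT₂⟩

end Doily

section InducedSpreads

/-- The embedding of the last four coordinates. -/
def embedLastFour : (Fin 4 → ZMod 2) →ₗ[ZMod 2] (Fin 6 → ZMod 2) where
  toFun x := ![0, 0, x 0, x 1, x 2, x 3]
  map_add' x y := by ext i; fin_cases i <;> simp
  map_smul' c x := by ext i; fin_cases i <;> simp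

lemma embedLastFour_injective : Function.Injective embedLastFour := by
  intro x y h
  ext i
  fin_cases i
  exacts [congrFun h 2, congrFun h 3, congrFun h 4, congrFun h 5]

lemma symplecticForm₆_embedLastFour (x : Fin 4 → ZMod 2) (c : Fin 6 → ZMod 2) :
    symplecticForm₆ (embedLastFour x) c = symplecticForm₄ x ![c 2, c 3, c 4, c 5] := by
  simp [embedLastFour, symplecticForm₆, symplecticForm₄]

/-- The two vectors of the standard hyperbolic pair orthogonal to the last four coordinates. -/
def IsFirstPairVector (r : Fin 6 → ZMod 2) : Prop :=
  r = ![1, 0, 0, 0, 0, 0] ∨ r = ![0, 1, 0, 0, 0, 0]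

lemma IsFirstPairVector.embedLastFour_ne_add {r : Fin 6 → ZMod 2} (hr : IsFirstPairVector r)
    (x y : Fin 4 → ZMod 2) : embedLastFour x ≠ r + embedLastFour y := by
  intro h
  rcases hr with rfl | rfl
  · simpa [embedLastFour] using congrFun h 0
  · simpa [embedLastFour] using congrFun h 1

lemma IsFirstPairVector.embedLastFour_ne {r : Fin 6 → ZMod 2} (hr : IsFirstPairVector r)
    (x : Fin 4 → ZMod 2) : embedLastFour x ≠ r := by
  simpa using hr.embedLastFour_ne_add x 0

lemma IsFirstPairVector.ne_zero {r : Fin 6 → ZMod 2} (hr : IsFirstPairVector r) : r ≠ 0 := by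
  simpa using (hr.embedLastFour_ne 0).symm

lemma IsFirstPairVector.symplecticForm₆_embedLastFour {r : Fin 6 → ZMod 2}
    (hr : IsFirstPairVector r) (x : Fin 4 → ZMod 2) :
    symplecticForm₆ r (embedLastFour x) = 0 := by
  rcases hr with rfl | rfl <;> simp [embedLastFour, symplecticForm₆]

lemma IsFirstPairVector.exists_eq_add {r c : Fin 6 → ZMod 2} (hr : IsFirstPairVector r)
    (hc : symplecticForm₆ r c = 0) :
    ∃ a : ZMod 2, c = a • r + embedLastFour ![c 2, c 3, c 4, c 5] := by
  rcases hr with rfl | rfl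
  · refine ⟨c 0, ?_⟩
    have : c 1 = 0 := by simpa [symplecticForm₆] using hc
    ext i; fin_cases i <;> simp [embedLastFour, this]
  · refine ⟨c 1, ?_⟩
    have : c 0 = 0 := by simpa [symplecticForm₆] using hc
    ext i; fin_cases i <;> simp [embedLastFour, this]

variable {F : Set (Submodule (ZMod 2) V72)} {H : Submodule (ZMod 2) V72}

lemma isSymplecticSpread_comap (hF : IsSpread23 F) {g : (Fin 6 → ZMod 2) →ₗ[ZMod 2] V72}
    (hinj : Function.Injective g) (hrange : ∀ v ∈ H, ∃ c, g c = v)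
    (hg : ∀ u v, symplecticForm₆ u v = 0 ↔ SpreadOrth F H (g u) (g v))
    {r : Fin 6 → ZMod 2} (hr : IsFirstPairVector r) :
    IsSymplecticSpread {L | ∃ S ∈ F, g r ∈ S ∧ L = S.comap (g ∘ₗ embedLastFour)} := by
  have hinj₀ : ∀ {u}, u ≠ 0 → g u ≠ 0 := fun hu => (map_ne_zero_iff g hinj).mpr hu
  have hr0 : g r ≠ 0 := hinj₀ hr.ne_zero
  have hx0 : ∀ {x}, x ≠ 0 → g (embedLastFour x) ≠ 0 := fun hx =>
    hinj₀ ((map_ne_zero_iff _ embedLastFour_injective).mpr hx)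
  have hrx : ∀ x, g r ≠ g (embedLastFour x) := fun x h => hr.embedLastFour_ne x (hinj h).symm
  refine ⟨fun x hx => ?_, ?_, ?_⟩
  · obtain h | h | h | ⟨S, hS, hrS, hxS, hle⟩ := (hg _ _).mp (hr.symplecticForm₆_embedLastFour x)
    · exact absurd h hr0
    · exact absurd h (hx0 hx)
    · exact absurd h (hrx x)
    obtain ⟨z, hz, hzs⟩ := exists_mem_notMem_of_finrank_lt (A := S)
      (B := Submodule.span (ZMod 2) {g r, g (embedLastFour x)})
      (by rw [finrank_span_pair_zmod_two hr0 (hx0 hx) (hrx x), hF.1 S hS]; norm_num)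
    obtain ⟨c, rfl⟩ := hrange z (hle hz)
    have hort : ∀ u, g u ∈ S → symplecticForm₆ u c = 0 := fun u hu =>
      (hg u c).mpr (Or.inr (Or.inr (Or.inr ⟨S, hS, hu, hz, hle⟩)))
    obtain ⟨a, ha⟩ := hr.exists_eq_add (hort r hrS)
    refine ⟨_, ⟨S, hS, hrS, rfl⟩, hxS, ![c 2, c 3, c 4, c 5], ?_, fun h => ?_, fun h => ?_, ?_⟩
    · rw [ha, map_add, map_smul] at hz
      exact (S.add_mem_iff_right (S.smul_mem a hrS)).mp hz
    · rw [ha, h, map_zero, add_zero, map_smul] at hzs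
      exact hzs (Submodule.smul_mem _ _ (Submodule.subset_span (by simp)))
    · rw [ha, h, map_add, map_smul] at hzs
      exact hzs (Submodule.add_mem _
        (Submodule.smul_mem _ _ (Submodule.subset_span (by simp)))
        (Submodule.subset_span (by simp)))
    · rw [← symplecticForm₆_embedLastFour]
      exact hort _ hxS
  · rintro _ ⟨S, hS, hrS, rfl⟩ _ ⟨T, hT, hrT, rfl⟩ x hx hxS hxT
    rw [hF.eq_of_mem hr0 (hx0 hx) (hrx x) hS hT hrS hxS hrT hxT]
  · rintro _ ⟨S, hS, hrS, rfl⟩ x hxS y hyS z hzS hx hy hxy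
    have hrs : g r ∉ Submodule.span (ZMod 2) {g (embedLastFour x), g (embedLastFour y)} := by
      rw [mem_span_pair_zmod_two, ← map_add, ← map_add]
      rintro (h | h | h | h)
      exacts [hr0 h, hrx _ h, hrx _ h, hrx _ h]
    obtain ⟨a, u, hu, huz⟩ := hF.mem_combination hS (hx0 hx) (hx0 hy)
      (fun h => hxy (embedLastFour_injective (hinj h))) hrs hxS hyS hrS hzS
    obtain ⟨w, hw, rfl⟩ : ∃ w, (w = 0 ∨ w = x ∨ w = y ∨ w = x + y) ∧ u = g (embedLastFour w) := by
      rw [mem_span_pair_zmod_two] at hu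
      rcases hu with rfl | rfl | rfl | rfl
      exacts [⟨0, by simp⟩, ⟨x, by simp⟩, ⟨y, by simp⟩, ⟨x + y, by simp⟩]
    rw [LinearMap.comp_apply, ← map_smul, ← map_add] at huz
    have huz := hinj huz
    obtain rfl | rfl := zmod_two_eq_zero_or_one a
    · rw [zero_smul, zero_add] at huz
      rwa [embedLastFour_injective huz]
    · rw [one_smul] at huz
      exact absurd huz (hr.embedLastFour_ne_add z w)

lemma not_geometricAtPoints (hF : IsSpread23 F) : ¬ GeometricAtPoints F := by
  intro hG
  let φ : V72 →ₗ[ZMod 2] ZMod 2 := LinearMap.proj 0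
  have hH6 : Module.finrank (ZMod 2) (LinearMap.ker φ) = 6 := by
    have h := LinearMap.finrank_range_add_finrank_ker φ
    rw [LinearMap.range_eq_top.mpr (LinearMap.proj_surjective 0), finrank_top,
      Module.finrank_self, Module.finrank_fin_fun] at h
    omega
  have hH : ∀ u v : V72, u ∉ LinearMap.ker φ → v ∉ LinearMap.ker φ → u + v ∈ LinearMap.ker φ := by
    intro u v hu hv
    rw [LinearMap.mem_ker] at hu hv ⊢
    rw [map_add, (zmod_two_eq_zero_or_one _).resolve_left hu,
      (zmod_two_eq_zero_or_one _).resolve_left hv, CharTwo.add_self_eq_zero]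
  obtain ⟨B, hB⟩ := exists_bilinForm_of_geometricAtPoints hF hG hH
  obtain ⟨e, he⟩ := exists_symplectic_coordinates hH6 B
    (fun x => (hB x x).mpr (Or.inr (Or.inr (Or.inl rfl))))
    (fun x y => by
      have : B x y = 0 ↔ B y x = 0 := by
        rw [hB, hB]
        exact ⟨.symm, .symm⟩
      obtain h | h := zmod_two_eq_zero_or_one (B x y) <;>
        obtain h' | h' := zmod_two_eq_zero_or_one (B y x) <;>
        rw [h, h'] at this ⊢ <;> tauto)
    (fun x hx => by
      obtain ⟨y, hy, hxy⟩ := exists_not_spreadOrth hF hG hH6 (x := x) (by simpa using hx)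
      exact ⟨⟨y, hy⟩, fun h => hxy ((hB _ _).mp h)⟩)
  let g : (Fin 6 → ZMod 2) →ₗ[ZMod 2] V72 := (LinearMap.ker φ).subtype ∘ₗ e.toLinearMap
  have hinj : Function.Injective g := Subtype.val_injective.comp e.injective
  have hrange : ∀ v ∈ LinearMap.ker φ, ∃ c, g c = v := fun v hv =>
    ⟨e.symm ⟨v, hv⟩, by simp [g]⟩
  have hg : ∀ u v, symplecticForm₆ u v = 0 ↔ SpreadOrth F (LinearMap.ker φ) (g u) (g v) := by
    intro u v
    rw [← he, hB]
    rfl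
  have hp : IsFirstPairVector ![1, 0, 0, 0, 0, 0] := Or.inl rfl
  have hq : IsFirstPairVector ![0, 1, 0, 0, 0, 0] := Or.inr rfl
  obtain ⟨_, ⟨S, hS, hpS, rfl⟩, _, ⟨T, hT, hqT, rfl⟩, x, y, hx, hy, hxy, hxS, hyS, hxT, hyT⟩ :=
    (isSymplecticSpread_comap hF hinj hrange hg hp).exists_common_line
      (isSymplecticSpread_comap hF hinj hrange hg hq)
  have hj : Function.Injective (g ∘ₗ embedLastFour) := hinj.comp embedLastFour_injective
  have hx0 : (g ∘ₗ embedLastFour) x ≠ 0 := (map_ne_zero_iff _ hj).mpr hx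
  obtain rfl : S = T := hF.eq_of_mem hx0 ((map_ne_zero_iff _ hj).mpr hy) (hj.ne hxy)
    hS hT hxS hyS hxT hyT
  have hp0 : g ![1, 0, 0, 0, 0, 0] ≠ 0 := (map_ne_zero_iff g hinj).mpr hp.ne_zero
  have hpx : g ![1, 0, 0, 0, 0, 0] ≠ (g ∘ₗ embedLastFour) x := fun h =>
    hp.embedLastFour_ne x (hinj h).symm
  obtain h | h | h | ⟨R, hR, hpR, hxR, hle⟩ := (hg _ _).mp (hp.symplecticForm₆_embedLastFour x)
  · exact hp0 h
  · exact hx0 h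
  · exact hpx h
  obtain rfl : S = R := hF.eq_of_mem hp0 hx0 hpx hS hR hpS hxS hpR hxR
  have hpq := (hg _ _).mpr (Or.inr (Or.inr (Or.inr ⟨S, hS, hpS, hqT, hle⟩)))
  exact absurd hpq (by decide)

end InducedSpreads

theorem exists_non_geometric_derived_spread (F : Set (Submodule (ZMod 2) V72))
    (hF : IsSpread23 F) :
    ∃ P : Submodule (ZMod 2) V72, Module.finrank (ZMod 2) P = 1 ∧
      ¬ IsGeometric {T : Submodule (ZMod 2) (V72 ⧸ P) |
        ∃ S ∈ F, P ≤ S ∧ T = S.map P.mkQ} := by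
  by_contra! h
  exact not_geometricAtPoints hF (geometricAtPoints_of_isGeometric h)
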